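/- arXiv:2503.13191 — 3 statements merged into one kernel-verified Lean document; each statement's English description precedes it below -/
import Mathlib

section
/- Let E be a finite nonempty set, 𝕏 = {0,1}^E, s : 𝕏 → ℝ^d a statistic and β ∈ ℝ^d, and let X be a random element of 𝕏 distributed according to the exponential random graph model ERGM(β), i.e. P(X = x) = exp(⟨β, s(x)⟩) / Σ_{y∈𝕏} exp(⟨β, s(y)⟩). Then for every function f : 𝕏 → ℝ one has E[ Σ_{m∈E} ( σ(⟨β, Δ_m s(X)⟩) · Δ_m f(X) + f(◊_m^0 X) − f(X) ) ] = 0; that is, the Glauber-dynamics operator is a Stein operator for ERGM(β). -/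
open scoped RealInnerProductSpace BigOperators
open Finset

noncomputable section

namespace LergmStein

/-- The sigmoid function `σ(t) = 1/(1+e^{−t})`. -/
def sigmoid (t : ℝ) : ℝ := 1 / (1 + Real.exp (-t))

/-- Set coordinate `m` of the configuration `y` to the value `b` (the operation `◊_m^b`). -/
def setC {ι : Type} [DecidableEq ι] (y : ι → Bool) (m : ι) (b : Bool) : ι → Bool :=
  Function.update y m b

/-- Discrete difference `Δ_m f(y) = f(◊_m^1 y) − f(◊_m^0 y)`. -/
def dd {ι W : Type} [DecidableEq ι] [AddCommGroup W] (f : (ι → Bool) → W)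
    (y : ι → Bool) (m : ι) : W :=
  f (setC y m true) - f (setC y m false)

/-- The relative weight of a state with log-weight `a` against one with log-weight `b`. -/
lemma sigmoid_sub (a b : ℝ) :
    sigmoid (a - b) = Real.exp a / (Real.exp a + Real.exp b) := by
  have ha := Real.exp_pos a
  have hb := Real.exp_pos b
  rw [sigmoid, neg_sub, Real.exp_sub]
  field_simp

lemma setC_setC {ι : Type} [DecidableEq ι] (y : ι → Bool) (m : ι) (a b : Bool) :
    setC (setC y m a) m b = setC y m b := by
  simp only [setC, Function.update_idem]

lemma setC_self {ι : Type} [DecidableEq ι] (y : ι → Bool) (m : ι) : setC y m (y m) = y :=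
  Function.update_eq_self m y

lemma setC_apply_self {ι : Type} [DecidableEq ι] (y : ι → Bool) (m : ι) (b : Bool) :
    setC y m b m = b := by
  simp only [setC, Function.update_self]

lemma dd_setC {ι W : Type} [DecidableEq ι] [AddCommGroup W] (f : (ι → Bool) → W)
    (y : ι → Bool) (m : ι) (b : Bool) : dd f (setC y m b) m = dd f y m := by
  simp only [dd, setC_setC]

/-- The terms at the two states of a coordinate balance each other (detailed balance). -/
lemma exp_mul_glauber_add_eq_zero {E : Type} [DecidableEq E] {d : ℕ}
    (s : (E → Bool) → EuclideanSpace ℝ (Fin d)) (β : EuclideanSpace ℝ (Fin d))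
    (f : (E → Bool) → ℝ) (x : E → Bool) (m : E) :
    Real.exp ⟪β, s (setC x m true)⟫ *
        (sigmoid ⟪β, dd s x m⟫ * dd f x m + f (setC x m false) - f (setC x m true)) +
      Real.exp ⟪β, s (setC x m false)⟫ *
        (sigmoid ⟪β, dd s x m⟫ * dd f x m + f (setC x m false) - f (setC x m false)) = 0 := by
  have h : sigmoid ⟪β, dd s x m⟫ *
      (Real.exp ⟪β, s (setC x m true)⟫ + Real.exp ⟪β, s (setC x m false)⟫) =
      Real.exp ⟪β, s (setC x m true)⟫ := by
    rw [dd, inner_sub_right, sigmoid_sub]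
    exact div_mul_cancel₀ _ (by positivity)
  have hf : dd f x m = f (setC x m true) - f (setC x m false) := rfl
  linear_combination dd f x m * h + Real.exp ⟪β, s (setC x m true)⟫ * hf

lemma sum_exp_mul_glauber_eq_zero {E : Type} [Fintype E] [DecidableEq E] {d : ℕ}
    (s : (E → Bool) → EuclideanSpace ℝ (Fin d)) (β : EuclideanSpace ℝ (Fin d))
    (f : (E → Bool) → ℝ) (m : E) :
    ∑ x : E → Bool, Real.exp ⟪β, s x⟫ *
      (sigmoid ⟪β, dd s x m⟫ * dd f x m + f (setC x m false) - f x) = 0 := by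
  refine Finset.sum_involution (fun x _ => setC x m (!x m)) ?_ ?_ (fun _ _ => mem_univ _) ?_
  · intro x _
    have h := exp_mul_glauber_add_eq_zero s β f x m
    have hx := setC_self x m
    simp only [dd_setC, setC_setC]
    cases hb : x m <;> rw [hb] at hx <;> simp only [Bool.not_true, Bool.not_false]
    · rw [hx] at h ⊢
      rwa [add_comm]
    · rwa [hx] at h
  · intro x _ _ hx
    have h := congrFun hx m
    rw [setC_apply_self] at h
    exact Bool.not_ne_self _ h
  · intro x _
    simp only [setC_setC, setC_apply_self, Bool.not_not, setC_self]

/-- Glauber-dynamics Stein identity for the ERGM.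
If `X ∼ ERGM(β)` on `𝕏 = {0,1}^E`, i.e. `P(X = x) = exp⟨β, s(x)⟩ / Σ_y exp⟨β, s(y)⟩`, then for
every `f : 𝕏 → ℝ`,
`E[ Σ_{m ∈ E} ( σ(⟨β, Δ_m s(X)⟩)·Δ_m f(X) + f(◊_m^0 X) − f(X) ) ] = 0`. -/
theorem ergm_stein_identity {E : Type} [Fintype E] [DecidableEq E] [Nonempty E] {d : ℕ}
    (s : (E → Bool) → EuclideanSpace ℝ (Fin d)) (β : EuclideanSpace ℝ (Fin d))
    (f : (E → Bool) → ℝ) :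
    ∑ x : E → Bool,
      (Real.exp ⟪β, s x⟫ / ∑ y : E → Bool, Real.exp ⟪β, s y⟫) *
        ∑ m : E, (sigmoid ⟪β, dd s x m⟫ * dd f x m + f (setC x m false) - f x) = 0 := by
  simp only [mul_sum, div_mul_eq_mul_div]
  rw [sum_comm]
  refine sum_eq_zero fun m _ => ?_
  rw [← sum_div, sum_exp_mul_glauber_eq_zero, zero_div]

end LergmStein
end
end

section
/- Let A be a finite vertex set with |A| ≥ 2, 𝕏 = {0,1}^{E(A)}, o : {0,…,|A|−1} → ℝ strictly decreasing, and s(x) = Σ_{i=0}^{|A|−1} o(i)·H_i(x). If x ∈ 𝕏 is neither the complete graph (all coordinates 1) nor the empty graph (all coordinates 0), then there exists m ∈ E(A) with s(x) − s(◊_m^0 x) < 0, and there exists m' ∈ E(A) with s(x) − s(◊_{m'}^0 x) > Δ_{m'} s(x). -/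
open Finset

noncomputable section

namespace LergmStein

/-- The set `E(A)` of potential edges: non-diagonal unordered pairs of vertices. -/
abbrev EdgeSet (V : Type) [DecidableEq V] : Type := {e : Sym2 V // ¬ e.IsDiag}

/-- Edge configurations `𝕏 = {0,1}^{E(A)}`. -/
abbrev Config (V : Type) [DecidableEq V] : Type := EdgeSet V → Bool

variable {V : Type} [Fintype V] [DecidableEq V]

/-- The degree `deg(w; x)` of a vertex `w` in the configuration `x`. -/
def deg (x : Config V) (w : V) : ℕ :=
  (Finset.univ.filter fun e : EdgeSet V => w ∈ e.1 ∧ x e = true).card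

/-- `H_i(x)`, the number of vertices of degree `i` in `x`. -/
def degCount (x : Config V) (i : ℕ) : ℕ :=
  (Finset.univ.filter fun w : V => deg x w = i).card

/-- The degree-based statistic `s(x) = Σ_{i=0}^{|A|−1} o(i)·H_i(x)`. -/
def degStat (o : ℕ → ℝ) (x : Config V) : ℝ :=
  ∑ i ∈ Finset.range (Fintype.card V), o i * degCount x i

/-- Every degree is smaller than the number of vertices. -/
theorem deg_lt_card (x : Config V) (w : V) : deg x w < Fintype.card V := by
  have hsub : (Finset.univ.filter fun e : EdgeSet V => w ∈ e.1 ∧ x e = true).image Subtype.val ⊆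
      (Finset.univ.erase w).image fun v => s(w, v) := by
    intro e he
    simp only [Finset.mem_image, Finset.mem_filter, Finset.mem_univ, true_and] at he
    obtain ⟨⟨e, hd⟩, ⟨hw, -⟩, rfl⟩ := he
    obtain ⟨v, rfl⟩ := Sym2.mem_iff_exists.mp hw
    refine Finset.mem_image.mpr ⟨v, ?_, rfl⟩
    simpa [eq_comm] using hd
  calc deg x w = _ := (Finset.card_image_of_injective _ Subtype.val_injective).symm
    _ ≤ _ := Finset.card_le_card hsub
    _ ≤ (Finset.univ.erase w).card := Finset.card_image_le
    _ < Fintype.card V := Finset.card_erase_lt_of_mem (Finset.mem_univ w)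

/-- The degree statistic as a sum over vertices. -/
theorem degStat_eq_sum (o : ℕ → ℝ) (x : Config V) : degStat o x = ∑ w : V, o (deg x w) := by
  rw [degStat, ← Finset.sum_fiberwise_of_maps_to (g := deg x)
    (t := Finset.range (Fintype.card V)) fun w _ => Finset.mem_range.mpr (deg_lt_card x w)]
  refine Finset.sum_congr rfl fun i _ => ?_
  rw [Finset.sum_congr rfl fun w hw => by rw [(Finset.mem_filter.mp hw).2],
    Finset.sum_const, nsmul_eq_mul, mul_comm, degCount]

theorem deg_setC_le (x : Config V) (m : EdgeSet V) (w : V) :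
    deg (setC x m false) w ≤ deg (setC x m true) w := by
  refine Finset.card_le_card fun e => ?_
  by_cases h : e = m <;> simp [setC, Function.update_apply, h]

theorem deg_setC_lt (x : Config V) (m : EdgeSet V) {w : V} (hw : w ∈ m.1) :
    deg (setC x m false) w < deg (setC x m true) w := by
  refine Finset.card_lt_card ((Finset.ssubset_iff_of_subset fun e => ?_).mpr ⟨m, ?_, ?_⟩)
  · by_cases h : e = m <;> simp [setC, Function.update_apply, h]
  · exact Finset.mem_filter.mpr ⟨Finset.mem_univ _, hw, by simp [setC]⟩
  · exact fun h => by simpa [setC] using (Finset.mem_filter.mp h).2.2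

/-- Adding an edge strictly decreases the statistic of a strictly decreasing `o`. -/
theorem degStat_setC_lt {o : ℕ → ℝ} (ho : StrictAntiOn o (Set.Iio (Fintype.card V)))
    (x : Config V) (m : EdgeSet V) :
    degStat o (setC x m true) < degStat o (setC x m false) := by
  rw [degStat_eq_sum, degStat_eq_sum]
  obtain ⟨w, hw⟩ : ∃ w, w ∈ m.1 := ⟨_, Sym2.out_fst_mem m.1⟩
  exact Finset.sum_lt_sum
    (fun v _ => ho.antitoneOn (deg_lt_card _ v) (deg_lt_card _ v) (deg_setC_le x m v))
    ⟨w, Finset.mem_univ w, ho (deg_lt_card _ w) (deg_lt_card _ w) (deg_setC_lt x m hw)⟩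

/-- non-degenerate observed graphs satisfy assumption (vi)'.
If `|A| ≥ 2`, `o` is strictly decreasing on `{0,…,|A|−1}`, and the configuration `x` is neither
complete nor empty, then there is an edge `m` with `s(x) − s(◊_m^0 x) < 0` and an edge `m'`
with `s(x) − s(◊_{m'}^0 x) > Δ_{m'} s(x)`. -/
theorem degStat_nondegenerate (hV : 2 ≤ Fintype.card V) (o : ℕ → ℝ)
    (ho : StrictAntiOn o (Set.Iio (Fintype.card V))) (x : Config V)
    (hfull : x ≠ fun _ => true) (hempty : x ≠ fun _ => false) :
    (∃ m : EdgeSet V, degStat o x - degStat o (setC x m false) < 0) ∧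
    (∃ m' : EdgeSet V, dd (degStat o) x m' < degStat o x - degStat o (setC x m' false)) := by
  constructor
  · obtain ⟨m, hm⟩ := Function.ne_iff.mp hempty
    have hx : setC x m true = x := by
      rw [← Bool.eq_true_of_not_eq_false hm]
      exact Function.update_eq_self m x
    have h := degStat_setC_lt ho x m
    rw [hx] at h
    exact ⟨m, sub_neg.mpr h⟩
  · obtain ⟨m, hm⟩ := Function.ne_iff.mp hfull
    have hx : setC x m false = x := by
      rw [← Bool.eq_false_of_not_eq_true hm]
      exact Function.update_eq_self m x
    have h := degStat_setC_lt ho x m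
    refine ⟨m, ?_⟩
    rw [dd]
    rw [hx] at h ⊢
    exact sub_lt_sub_right h _

end LergmStein
end
end

section
/- Deterministic second-order lower bound for the Stein objective: let v_1, …, v_n ∈ ℝ^d with ‖v_i‖ ≤ L for all i, let R > 0 and let β, β* ∈ ℝ^d with ‖β‖ ≤ R and ‖β*‖ ≤ R. Then Σ_{i=1}^n [ Σ(⟨β, v_i⟩) − Σ(⟨β*, v_i⟩) − σ(⟨β*, v_i⟩)·⟨β − β*, v_i⟩ ] ≥ (1/2)·σ'(R·L)·Σ_{i=1}^n ⟨β − β*, v_i⟩², where Σ(t) = log(1+e^t), σ(t) = 1/(1+e^{−t}) = Σ'(t) and σ'(t) = Σ''(t). -/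
open scoped RealInnerProductSpace BigOperators
open Finset

noncomputable section

namespace LergmStein

/-- The derivative of the sigmoid, `σ'(t) = e^{−t}/(1+e^{−t})²`. -/
def dsigmoid (t : ℝ) : ℝ := Real.exp (-t) / (1 + Real.exp (-t)) ^ 2

/-- `Σ(t) = log(1+e^t)`, the primitive of the sigmoid (so `Σ' = σ`, `Σ'' = σ'`). -/
def logSig (t : ℝ) : ℝ := Real.log (1 + Real.exp t)

lemma dsigmoid_eq_inv_cosh (t : ℝ) : dsigmoid t = (2 + 2 * Real.cosh t)⁻¹ := by
  have h := Real.exp_pos t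
  rw [dsigmoid, Real.cosh_eq, Real.exp_neg]
  field_simp
  ring

lemma dsigmoid_le_of_abs_le {s t : ℝ} (h : |s| ≤ |t|) : dsigmoid t ≤ dsigmoid s := by
  have hcosh := Real.cosh_le_cosh.2 h
  have hs := Real.cosh_pos s
  rw [dsigmoid_eq_inv_cosh, dsigmoid_eq_inv_cosh]
  gcongr

lemma hasDerivAt_logSig (t : ℝ) : HasDerivAt logSig (sigmoid t) t := by
  have h := Real.exp_pos t
  refine (((Real.hasDerivAt_exp t).const_add 1).log (by positivity)).congr_deriv ?_
  rw [sigmoid, Real.exp_neg]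
  field_simp
  ring

lemma hasDerivAt_sigmoid (t : ℝ) : HasDerivAt sigmoid (dsigmoid t) t := by
  have h : sigmoid = Real.sigmoid := by
    funext x
    rw [sigmoid, Real.sigmoid_def, one_div]
  rw [h]
  refine (Real.hasDerivAt_sigmoid t).congr_deriv ?_
  rw [dsigmoid, Real.sigmoid_def]
  field_simp
  ring

/-- The tangent line inequality for a convex function on a set of reals. -/
lemma _root_.ConvexOn.mul_sub_le_sub_of_hasDerivAt {S : Set ℝ} {f : ℝ → ℝ} {f' x y : ℝ}
    (hf : ConvexOn ℝ S f) (hx : x ∈ S) (hy : y ∈ S) (hf' : HasDerivAt f f' x) :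
    f' * (y - x) ≤ f y - f x := by
  rcases lt_trichotomy x y with hxy | rfl | hxy
  · have h := hf.le_slope_of_hasDerivAt hx hy hxy hf'
    rwa [slope_def_field, le_div_iff₀ (sub_pos.2 hxy)] at h
  · simp
  · have h := hf.slope_le_of_hasDerivAt hy hx hxy hf'
    rw [slope_def_field, div_le_iff₀ (sub_pos.2 hxy)] at h
    linarith

/-- A lower bound `c` on the second derivative yields a quadratic lower bound on the first-order
Taylor remainder. -/
lemma half_mul_sq_le_taylor_remainder {S : Set ℝ} (hS : Convex ℝ S) {f f' f'' : ℝ → ℝ} {c : ℝ}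
    (hf : ∀ t, HasDerivAt f (f' t) t) (hf' : ∀ t, HasDerivAt f' (f'' t) t)
    (hc : ∀ t ∈ S, c ≤ f'' t) {x y : ℝ} (hx : x ∈ S) (hy : y ∈ S) :
    1 / 2 * c * (y - x) ^ 2 ≤ f y - f x - f' x * (y - x) := by
  have hg (t : ℝ) : HasDerivAt (fun u ↦ f u - c / 2 * u ^ 2) (f' t - c * t) t :=
    ((hf t).sub ((hasDerivAt_pow 2 t).const_mul (c / 2))).congr_deriv (by norm_num; ring)
  have hg' (t : ℝ) : HasDerivAt (fun u ↦ f' u - c * u) (f'' t - c) t :=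
    ((hf' t).sub ((hasDerivAt_id t).const_mul c)).congr_deriv (by simp)
  have hconv : ConvexOn ℝ S (fun u ↦ f u - c / 2 * u ^ 2) :=
    convexOn_of_hasDerivWithinAt2_nonneg hS (fun t _ ↦ (hg t).continuousAt.continuousWithinAt)
      (fun t _ ↦ (hg t).hasDerivWithinAt) (fun t _ ↦ (hg' t).hasDerivWithinAt)
      (fun t ht ↦ sub_nonneg.2 (hc t (interior_subset ht)))
  have h := hconv.mul_sub_le_sub_of_hasDerivAt hx hy (hg x)
  linarith

lemma logSig_second_order_bound {M a b : ℝ} (ha : |a| ≤ M) (hb : |b| ≤ M) :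
    1 / 2 * dsigmoid M * (a - b) ^ 2 ≤ logSig a - logSig b - sigmoid b * (a - b) :=
  half_mul_sq_le_taylor_remainder (convex_Icc (-M) M) hasDerivAt_logSig hasDerivAt_sigmoid
    (fun _ ht ↦ dsigmoid_le_of_abs_le ((abs_le.2 ht).trans (le_abs_self M)))
    (abs_le.1 hb) (abs_le.1 ha)

/-- deterministic second-order lower bound for the Stein objective.
Let `v₁, …, v_n ∈ ℝ^d` with `‖v_i‖ ≤ L`, `R > 0`, and `‖β‖ ≤ R`, `‖β*‖ ≤ R`. Then
`Σ_i [Σ(⟨β, v_i⟩) − Σ(⟨β*, v_i⟩) − σ(⟨β*, v_i⟩)⟨β − β*, v_i⟩]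
  ≥ (1/2)·σ'(R·L)·Σ_i ⟨β − β*, v_i⟩²`. -/
theorem stein_objective_second_order_bound {d n : ℕ} (L R : ℝ) (hR : 0 < R)
    (v : Fin n → EuclideanSpace ℝ (Fin d)) (hv : ∀ i, ‖v i‖ ≤ L)
    (β βs : EuclideanSpace ℝ (Fin d)) (hβ : ‖β‖ ≤ R) (hβs : ‖βs‖ ≤ R) :
    (1 / 2) * dsigmoid (R * L) * ∑ i, ⟪β - βs, v i⟫ ^ 2 ≤
      ∑ i, (logSig ⟪β, v i⟫ - logSig ⟪βs, v i⟫ - sigmoid ⟪βs, v i⟫ * ⟪β - βs, v i⟫) := by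
  have hbound (γ : EuclideanSpace ℝ (Fin d)) (hγ : ‖γ‖ ≤ R) (i : Fin n) : |⟪γ, v i⟫| ≤ R * L :=
    (abs_real_inner_le_norm γ (v i)).trans (mul_le_mul hγ (hv i) (norm_nonneg _) hR.le)
  rw [Finset.mul_sum]
  refine Finset.sum_le_sum fun i _ ↦ ?_
  rw [inner_sub_left]
  exact logSig_second_order_bound (hbound β hβ i) (hbound βs hβs i)

end LergmStein
end
end
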